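/- (Kato smoothing effect for the Benjamin–Ono group) For every φ ∈ S(ℝ) and every T > 0, ‖D_x^{1/2} V(t) φ‖_{L^∞_x L^2_T} ≲ ‖φ‖_{L²(ℝ)}, with implicit constant independent of φ and T. -/

import Mathlib

open MeasureTheory Real Set Filter
open scoped FourierTransform ENNReal NNReal Topology

noncomputable section

/-- Fourier multiplier operator with symbol `m`. -/
def FMul (m : ℝ → ℂ) (f : ℝ → ℂ) : ℝ → ℂ :=
  𝓕⁻ fun ξ => m ξ * 𝓕 f ξ

/-- `D_x^α`, the Fourier multiplier with symbol `|ξ|^α`. -/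
def Dop (α : ℝ) (f : ℝ → ℂ) : ℝ → ℂ :=
  FMul (fun ξ => ((|ξ| ^ α : ℝ) : ℂ)) f

/-- The free Benjamin–Ono group `V(t) = 𝓕⁻¹ e^{itξ|ξ|} 𝓕`. -/
def BOGroup (t : ℝ) (f : ℝ → ℂ) : ℝ → ℂ :=
  FMul (fun ξ => Complex.exp (Complex.I * (t * ξ * |ξ|))) f

/-- The derivative `∂ₓ` as the Fourier multiplier with symbol `iξ`. -/
def Dx1 (f : ℝ → ℂ) : ℝ → ℂ :=
  FMul (fun ξ => Complex.I * ξ) f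

/-- Projection on nonnegative frequencies. -/
def Pplus (f : ℝ → ℂ) : ℝ → ℂ :=
  FMul (fun ξ => if 0 ≤ ξ then 1 else 0) f

/-- Projection on nonpositive frequencies. -/
def Pminus (f : ℝ → ℂ) : ℝ → ℂ :=
  FMul (fun ξ => if ξ ≤ 0 then 1 else 0) f

/-- The Sobolev `H^s` norm. -/
def HsNorm (s : ℝ) (f : ℝ → ℂ) : ℝ≥0∞ :=
  eLpNorm (fun ξ => (((1 + ξ ^ 2) ^ (s / 2) : ℝ) : ℂ) * 𝓕 f ξ) 2 volume

/-- The mixed space-time norm `L^p_x L^q_T`. -/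
def LpLq (p q : ℝ≥0∞) (T : ℝ) (f : ℝ → ℝ → ℂ) : ℝ≥0∞ :=
  eLpNorm (fun x => (eLpNorm (fun t => f x t) q (volume.restrict (Ioc (0:ℝ) T))).toReal) p volume

/-- The mixed space-time norm `L^q_T L^p_x`. -/
def LqLp (q p : ℝ≥0∞) (T : ℝ) (f : ℝ → ℝ → ℂ) : ℝ≥0∞ :=
  eLpNorm (fun t => (eLpNorm (fun x => f x t) p volume).toReal) q (volume.restrict (Ioc (0:ℝ) T))

/-- The norm `L^∞_T H^s_x`. -/
def LinfHs (s : ℝ) (T : ℝ) (f : ℝ → ℝ → ℂ) : ℝ≥0∞ :=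
  eLpNorm (fun t => (HsNorm s (fun x => f x t)).toReal) ∞ (volume.restrict (Ioc (0:ℝ) T))

/-- Apply a spatial operator slice-wise in time. -/
def sliceOp (A : (ℝ → ℂ) → (ℝ → ℂ)) (f : ℝ → ℝ → ℂ) : ℝ → ℝ → ℂ :=
  fun x t => A (fun y => f y t) x

/-- A smooth nonnegative bump `η` supported in `{1/2 ≤ |ξ| ≤ 2}` giving a dyadic
partition of unity `Σ_k η(2^{-k} ξ) = 1` for `ξ ≠ 0`. -/
structure IsLPBump (η : ℝ → ℝ) : Prop where
  smooth : ContDiff ℝ (⊤ : ℕ∞) η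
  nonneg : ∀ ξ, 0 ≤ η ξ
  support : ∀ ξ, η ξ ≠ 0 → 1/2 ≤ |ξ| ∧ |ξ| ≤ 2
  partition : ∀ ξ : ℝ, ξ ≠ 0 → ∑' k : ℤ, η ((2:ℝ) ^ (-k) * ξ) = 1

/-- The low-frequency symbol `p(ξ) = Σ_{j ≤ -3} η(2^{-j} ξ)`. -/
def lowSymbol (η : ℝ → ℝ) (ξ : ℝ) : ℝ :=
  ∑' j : ℤ, if j ≤ -3 then η ((2:ℝ) ^ (-j) * ξ) else 0

/-- The low-frequency projection `P₀`. -/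
def P0 (η : ℝ → ℝ) (f : ℝ → ℂ) : ℝ → ℂ :=
  FMul (fun ξ => ((lowSymbol η ξ : ℝ) : ℂ)) f

/-- The `X^s_T` norm. -/
def XNorm (η : ℝ → ℝ) (s T : ℝ) (u : ℝ → ℝ → ℂ) : ℝ≥0∞ :=
  LinfHs s T u + LpLq ∞ 2 T (sliceOp (Dop (s + 1/2)) u)
    + LpLq 4 ∞ T (sliceOp (Dop (s - 1/4)) u)
    + LpLq 2 ∞ T (sliceOp (P0 η) u)

/-- The Duhamel integral `∫₀ᵗ V(t-τ) f(τ) dτ`. -/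
def duhamel (f : ℝ → ℝ → ℂ) : ℝ → ℝ → ℂ :=
  fun x t => ∫ τ in Ioc (0:ℝ) t, BOGroup (t - τ) (fun y => f y τ) x

theorem hasDerivAt_mul_abs (x : ℝ) : HasDerivAt (fun y : ℝ => y * |y|) (2 * |x|) x := by
  rcases eq_or_ne x 0 with rfl | hx
  · rw [hasDerivAt_iff_tendsto_slope]
    have h : Tendsto (fun y : ℝ => |y|) (𝓝[≠] 0) (𝓝 (2 * |0|)) := by
      simpa using (continuous_abs.tendsto (0 : ℝ)).mono_left nhdsWithin_le_nhds
    refine h.congr' ?_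
    filter_upwards [self_mem_nhdsWithin] with y hy
    have hy' : y ≠ 0 := hy
    simp [slope_def_field, hy']
  · refine ((hasDerivAt_id x).mul (hasDerivAt_abs hx)).congr_deriv ?_
    have := self_mul_sign x
    simp only [id]
    linarith

theorem injective_mul_abs : Function.Injective (fun y : ℝ => y * |y|) := by
  intro x y h
  simp only at h
  rcases abs_cases x with ⟨h1, h2⟩ | ⟨h1, h2⟩ <;> rcases abs_cases y with ⟨h3, h4⟩ | ⟨h3, h4⟩ <;>
    rw [h1, h3] at h <;> nlinarith

theorem lintegral_abs_mul_comp_sub_mul_abs_le (K : ℝ → ℝ≥0∞) (c : ℝ) :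
    ∫⁻ y, ENNReal.ofReal (2 * |y|) * K (c - y * |y|) ≤ ∫⁻ y, K y := by
  have h := lintegral_image_eq_lintegral_abs_deriv_mul (s := univ) MeasurableSet.univ
    (fun x _ => (hasDerivAt_mul_abs x).hasDerivWithinAt) injective_mul_abs.injOn
    (fun y => K (c - y))
  simp only [abs_mul, abs_two, abs_abs, Measure.restrict_univ] at h
  rw [← h, ← lintegral_sub_left_eq_self K c]
  exact setLIntegral_le_lintegral _ _

theorem lintegral_lintegral_weight_kernel_le {K B : ℝ → ℝ≥0∞} (hK : Measurable K)
    (hKe : ∀ x, K (-x) = K x) (hB : Measurable B) :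
    ∫⁻ x, ∫⁻ y, (ENNReal.ofReal (2 * |y|) * B x + ENNReal.ofReal (2 * |x|) * B y) *
      K (x * |x| - y * |y|) ≤ 2 * (∫⁻ y, K y) * ∫⁻ x, B x := by
  have key : ∫⁻ x, ∫⁻ y, B x * (ENNReal.ofReal (2 * |y|) * K (x * |x| - y * |y|)) ≤
      (∫⁻ y, K y) * ∫⁻ x, B x := by
    rw [← lintegral_const_mul _ hB]
    refine lintegral_mono fun x => ?_
    rw [lintegral_const_mul _ (by fun_prop), mul_comm]
    refine mul_le_mul_left ?_ _
    exact lintegral_abs_mul_comp_sub_mul_abs_le K _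
  have hm : Measurable (Function.uncurry fun x y : ℝ =>
      B x * (ENNReal.ofReal (2 * |y|) * K (x * |x| - y * |y|))) := by
    unfold Function.uncurry
    fun_prop
  calc _ = ∫⁻ x, ((∫⁻ y, B x * (ENNReal.ofReal (2 * |y|) * K (x * |x| - y * |y|))) +
        ∫⁻ y, B y * (ENNReal.ofReal (2 * |x|) * K (y * |y| - x * |x|))) := by
        refine lintegral_congr fun x => ?_
        rw [← lintegral_add_left (by fun_prop)]
        refine lintegral_congr fun y => ?_
        rw [← hKe (y * |y| - x * |x|), neg_sub]
        ring
    _ = (∫⁻ x, ∫⁻ y, B x * (ENNReal.ofReal (2 * |y|) * K (x * |x| - y * |y|))) +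
        ∫⁻ x, ∫⁻ y, B y * (ENNReal.ofReal (2 * |x|) * K (y * |y| - x * |x|)) :=
        lintegral_add_left hm.lintegral_prod_right' _
    _ = (∫⁻ x, ∫⁻ y, B x * (ENNReal.ofReal (2 * |y|) * K (x * |x| - y * |y|))) +
        ∫⁻ x, ∫⁻ y, B x * (ENNReal.ofReal (2 * |y|) * K (x * |x| - y * |y|)) := by
        rw [lintegral_lintegral_swap (f := fun x y : ℝ =>
          B x * (ENNReal.ofReal (2 * |y|) * K (x * |x| - y * |y|))) hm.aemeasurable]
    _ ≤ _ := by
        rw [mul_assoc, two_mul]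
        gcongr

/-- The Fourier transform of the Gaussian `exp (-ε t²)`, in the normalization `∫ e^{ist}`. -/
def gaussKernel (ε s : ℝ) : ℝ := √(π / ε) * rexp (-(1 / (4 * ε)) * s ^ 2)

theorem integral_gaussian_mul_cexp {ε : ℝ} (hε : 0 < ε) (s : ℝ) :
    ∫ t : ℝ, Complex.exp (-ε * t ^ 2) * Complex.exp (Complex.I * (t * s)) = gaussKernel ε s := by
  have h := fourierIntegral_gaussian (b := (ε : ℂ)) (by simpa using hε) s
  have h2 : ((π : ℂ) / ε) ^ (1 / 2 : ℂ) = ((√(π / ε) : ℝ) : ℂ) := by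
    rw [Real.sqrt_eq_rpow, Complex.ofReal_cpow (by positivity)]
    push_cast
    rfl
  rw [h2] at h
  unfold gaussKernel
  push_cast
  calc _ = ∫ t : ℝ, Complex.exp (Complex.I * s * t) * Complex.exp (-ε * t ^ 2) := by
        refine integral_congr_ae (ae_of_all _ fun t => ?_)
        simp only
        rw [mul_comm]
        congr 2
        ring
    _ = _ := h
    _ = _ := by
        congr 2
        ring

theorem lintegral_gaussKernel {ε : ℝ} (hε : 0 < ε) :
    ∫⁻ s, ENNReal.ofReal (gaussKernel ε s) = ENNReal.ofReal (2 * π) := by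
  unfold gaussKernel
  rw [← ofReal_integral_eq_lintegral_ofReal
    ((integrable_exp_neg_mul_sq (by positivity)).const_mul _) (ae_of_all _ fun s => by positivity),
    integral_const_mul, integral_gaussian, ← Real.sqrt_mul (by positivity)]
  congr 1
  rw [show π / ε * (π / (1 / (4 * ε))) = (2 * π) ^ 2 by field_simp; ring]
  exact Real.sqrt_sq (by positivity)

theorem lintegral_gaussian_mul_oscillatory_le {ε : ℝ} (hε : 0 < ε) {a : ℝ → ℂ}
    (ha : Integrable a) {θ : ℝ → ℝ} (hθ : Continuous θ) :
    ∫⁻ t : ℝ, ENNReal.ofReal (rexp (-ε * t ^ 2)) *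
        ‖∫ x, a x * Complex.exp (Complex.I * (t * θ x))‖ₑ ^ 2 ≤
      ∫⁻ x, ∫⁻ y, ‖a x‖ₑ * ‖a y‖ₑ * ENNReal.ofReal (gaussKernel ε (θ x - θ y)) := by
  set v : ℝ → ℂ := fun t => ∫ x, a x * Complex.exp (Complex.I * (t * θ x))
  set e : ℝ → ℝ → ℂ := fun t x => Complex.exp (Complex.I * (t * θ x)) with he
  have hconj : ∀ t x, (starRingEnd ℂ) (e t x) = Complex.exp (-(Complex.I * (t * θ x))) := by
    intro t x
    simp [he, ← Complex.exp_conj]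
  let F : ℝ → ℝ × ℝ → ℂ := fun t p =>
    Complex.exp (-ε * t ^ 2) * (a p.1 * (starRingEnd ℂ) (a p.2)) *
      Complex.exp (Complex.I * (t * (θ p.1 - θ p.2)))
  have hFe : ∀ t p, F t p = Complex.exp (-ε * t ^ 2) *
      ((a p.1 * e t p.1) * (starRingEnd ℂ) (a p.2 * e t p.2)) := by
    intro t p
    have : Complex.exp (Complex.I * (t * (θ p.1 - θ p.2))) =
        e t p.1 * (starRingEnd ℂ) (e t p.2) := by
      rw [hconj, he, ← Complex.exp_add]
      congr 1
      ring
    simp only [F, this, map_mul]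
    ring
  have hFint : Integrable (Function.uncurry F) (volume.prod (volume.prod volume)) := by
    have h1 : Integrable (fun p : ℝ × ℝ => a p.1 * (starRingEnd ℂ) (a p.2)) (volume.prod volume) :=
      ha.mul_prod ((integrable_norm_iff
        (Complex.continuous_conj.comp_aestronglyMeasurable ha.1)).1 (by simpa using ha.norm))
    have h2 := (integrable_cexp_neg_mul_sq (b := (ε : ℂ)) (by simpa using hε)).mul_prod h1
    refine h2.mul_bdd (c := 1) (Continuous.aestronglyMeasurable (by fun_prop))
      (ae_of_all _ fun z => ?_)
    rw [Complex.norm_exp]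
    simp
  have hFv : ∀ t, ∫ p, F t p ∂(volume.prod volume) =
      ((rexp (-ε * t ^ 2) * ‖v t‖ ^ 2 : ℝ) : ℂ) := by
    intro t
    simp only [hFe]
    rw [integral_const_mul, integral_prod_mul (fun x => a x * e t x)
      (fun y => (starRingEnd ℂ) (a y * e t y)), integral_conj, Complex.mul_conj,
      Complex.normSq_eq_norm_sq]
    push_cast
    rfl
  have hswap : ∫ t, ∫ p, F t p ∂(volume.prod volume) =
      ∫ p : ℝ × ℝ, (a p.1 * (starRingEnd ℂ) (a p.2)) * gaussKernel ε (θ p.1 - θ p.2)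
        ∂(volume.prod volume) := by
    rw [integral_integral_swap hFint]
    refine integral_congr_ae (ae_of_all _ fun p => ?_)
    simp only
    rw [← integral_gaussian_mul_cexp hε, ← integral_const_mul]
    refine integral_congr_ae (ae_of_all _ fun t => ?_)
    simp only [F]
    push_cast
    ring
  have hv_int := hFint.integral_prod_left
  simp only [Function.uncurry, hFv] at hv_int hswap
  have hv_re : Integrable fun t => rexp (-ε * t ^ 2) * ‖v t‖ ^ 2 := hv_int.re
  have hle : ∀ t : ℝ, 0 ≤ rexp (-ε * t ^ 2) * ‖v t‖ ^ 2 := fun t => by positivity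
  calc _ = ∫⁻ t, ENNReal.ofReal (rexp (-ε * t ^ 2) * ‖v t‖ ^ 2) := by
        refine lintegral_congr fun t => ?_
        rw [ENNReal.ofReal_mul (by positivity), ENNReal.ofReal_pow (by positivity), ofReal_norm]
    _ = ‖∫ t, ((rexp (-ε * t ^ 2) * ‖v t‖ ^ 2 : ℝ) : ℂ)‖ₑ := by
        rw [integral_complex_ofReal, ← ofReal_integral_eq_lintegral_ofReal
          hv_re (ae_of_all _ hle), ← ofReal_norm, Complex.norm_real,
          Real.norm_of_nonneg (integral_nonneg hle)]
    _ ≤ ∫⁻ p : ℝ × ℝ, ‖(a p.1 * (starRingEnd ℂ) (a p.2)) * gaussKernel ε (θ p.1 - θ p.2)‖ₑ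
        ∂(volume.prod volume) := by
        rw [hswap]
        exact enorm_integral_le_lintegral_enorm _
    _ ≤ ∫⁻ x, ∫⁻ y, ‖(a x * (starRingEnd ℂ) (a y)) * gaussKernel ε (θ x - θ y)‖ₑ :=
        lintegral_prod_le _
    _ = _ := by
        refine lintegral_congr fun x => lintegral_congr fun y => ?_
        rw [enorm_mul, enorm_mul, RCLike.enorm_conj]
        congr 1
        rw [← ofReal_norm, Complex.norm_real, Real.norm_of_nonneg]
        unfold gaussKernel
        positivity

theorem lintegral_oscillatory_sq_le {T : ℝ} (hT : 0 < T) {b : ℝ → ℂ} (hb : Continuous b)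
    (ha : Integrable fun x => ((|x| ^ (1 / 2 : ℝ) : ℝ) : ℂ) * b x) :
    ∫⁻ t in Ioc 0 T, ‖∫ x, ((|x| ^ (1 / 2 : ℝ) : ℝ) : ℂ) * b x *
        Complex.exp (Complex.I * (t * (x * |x| : ℝ)))‖ₑ ^ 2 ≤ 36 * ∫⁻ x, ‖b x‖ₑ ^ 2 := by
  set ε := 1 / T ^ 2 with hε_def
  have hε : 0 < ε := by positivity
  have h1 := lintegral_gaussian_mul_oscillatory_le hε ha (θ := fun x => x * |x|) (by fun_prop)
  have hbm : Measurable fun x => ‖b x‖ₑ ^ 2 := (hb.measurable.enorm).pow_const 2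
  have h2 := lintegral_lintegral_weight_kernel_le
    (K := fun s => ENNReal.ofReal (gaussKernel ε s)) (B := fun x => ‖b x‖ₑ ^ 2)
    (by unfold gaussKernel; fun_prop) (fun x => by simp [gaussKernel]) hbm
  rw [lintegral_gaussKernel hε] at h2
  have h3 : ∀ x y : ℝ, ‖((|x| ^ (1 / 2 : ℝ) : ℝ) : ℂ) * b x‖ₑ *
      ‖((|y| ^ (1 / 2 : ℝ) : ℝ) : ℂ) * b y‖ₑ ≤
      ENNReal.ofReal (2 * |y|) * ‖b x‖ₑ ^ 2 + ENNReal.ofReal (2 * |x|) * ‖b y‖ₑ ^ 2 := by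
    intro x y
    simp only [← ofReal_norm]
    rw [← ENNReal.ofReal_pow (by positivity), ← ENNReal.ofReal_pow (by positivity),
      ← ENNReal.ofReal_mul (by positivity), ← ENNReal.ofReal_mul (by positivity),
      ← ENNReal.ofReal_mul (by positivity), ← ENNReal.ofReal_add (by positivity) (by positivity)]
    refine ENNReal.ofReal_le_ofReal ?_
    simp only [norm_mul, Complex.norm_real, ← Real.sqrt_eq_rpow,
      Real.norm_of_nonneg (Real.sqrt_nonneg _)]
    have hx := Real.sq_sqrt (abs_nonneg x)
    have hy := Real.sq_sqrt (abs_nonneg y)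
    nlinarith [sq_nonneg (√|y| * ‖b x‖ - √|x| * ‖b y‖), sq_nonneg (√|y| * ‖b x‖),
      sq_nonneg (√|x| * ‖b y‖)]
  have h4 : ENNReal.ofReal (rexp 1) * (2 * ENNReal.ofReal (2 * π)) ≤ 36 := by
    rw [show (2 : ℝ≥0∞) = ENNReal.ofReal 2 by simp, show (36 : ℝ≥0∞) = ENNReal.ofReal 36 by simp,
      ← ENNReal.ofReal_mul (by positivity), ← ENNReal.ofReal_mul (by positivity)]
    refine ENNReal.ofReal_le_ofReal ?_
    nlinarith [Real.exp_one_lt_d9, Real.pi_lt_d2, Real.pi_pos, Real.exp_pos 1]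
  set v : ℝ → ℂ := fun t => ∫ x, ((|x| ^ (1 / 2 : ℝ) : ℝ) : ℂ) * b x *
        Complex.exp (Complex.I * (t * (x * |x| : ℝ)))
  calc ∫⁻ t in Ioc 0 T, ‖v t‖ₑ ^ 2
      ≤ ∫⁻ t in Ioc 0 T, ENNReal.ofReal (rexp 1) *
          (ENNReal.ofReal (rexp (-ε * t ^ 2)) * ‖v t‖ₑ ^ 2) := by
        refine setLIntegral_mono' measurableSet_Ioc fun t ht => ?_
        rw [← mul_assoc, ← ENNReal.ofReal_mul (by positivity), ← Real.exp_add]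
        refine le_mul_of_one_le_left (by positivity) ?_
        rw [← ENNReal.ofReal_one]
        refine ENNReal.ofReal_le_ofReal (Real.one_le_exp ?_)
        have : ε * t ^ 2 ≤ 1 := by
          rw [hε_def, one_div, inv_mul_le_one₀ (by positivity)]
          exact pow_le_pow_left₀ ht.1.le ht.2 2
        linarith
    _ ≤ ∫⁻ t, ENNReal.ofReal (rexp 1) *
          (ENNReal.ofReal (rexp (-ε * t ^ 2)) * ‖v t‖ₑ ^ 2) := setLIntegral_le_lintegral _ _
    _ = ENNReal.ofReal (rexp 1) *
          ∫⁻ t, (ENNReal.ofReal (rexp (-ε * t ^ 2)) * ‖v t‖ₑ ^ 2) :=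
        lintegral_const_mul' _ _ ENNReal.ofReal_ne_top
    _ ≤ ENNReal.ofReal (rexp 1) * (2 * ENNReal.ofReal (2 * π) * ∫⁻ x, ‖b x‖ₑ ^ 2) := by
        gcongr
        refine h1.trans (le_trans ?_ h2)
        refine lintegral_mono fun x => lintegral_mono fun y => ?_
        exact mul_le_mul_left (h3 x y) _
    _ ≤ _ := by
        rw [← mul_assoc]
        gcongr

theorem eLpNorm_two_sq {α E : Type*} [MeasurableSpace α] [NormedAddCommGroup E] (μ : Measure α)
    (f : α → E) : eLpNorm f 2 μ ^ 2 = ∫⁻ x, ‖f x‖ₑ ^ 2 ∂μ := by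
  simpa using eLpNorm_nnreal_pow_eq_lintegral (μ := μ) (f := f) (p := 2) two_ne_zero

theorem SchwartzMap.lintegral_enorm_fourier_sq (φ : SchwartzMap ℝ ℂ) :
    ∫⁻ x, ‖𝓕 (φ : ℝ → ℂ) x‖ₑ ^ 2 = eLpNorm φ 2 volume ^ 2 := by
  rw [← eLpNorm_two_sq, ← SchwartzMap.fourier_coe]
  have h := SchwartzMap.norm_fourier_toL2_eq φ
  rw [SchwartzMap.norm_toLp, SchwartzMap.norm_toLp] at h
  have h2 := (ENNReal.toReal_eq_toReal_iff' ((𝓕 φ).memLp 2 volume).2.ne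
    (φ.memLp 2 volume).2.ne).1 h
  rw [h2]

theorem fourier_fourierInv_eq_or_zero {g : ℝ → ℂ} (hg : Integrable g) (hc : Continuous g) :
    𝓕 (𝓕⁻ g) = g ∨ 𝓕 (𝓕⁻ g) = 0 := by
  by_cases h : Integrable (𝓕⁻ g)
  · left
    refine hc.fourier_fourierInv_eq hg ?_
    simpa [Real.fourierInv_eq_fourier_neg] using h.comp_neg
  · right
    ext w
    rw [Real.fourier_eq, integral_undef]
    · rfl
    · rwa [← Real.fourierIntegral_convergent_iff w] at h

theorem integrable_abs_rpow_half_mul_fourier (φ : SchwartzMap ℝ ℂ) :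
    Integrable fun ξ => ((|ξ| ^ (1 / 2 : ℝ) : ℝ) : ℂ) * 𝓕 (φ : ℝ → ℂ) ξ := by
  rw [← SchwartzMap.fourier_coe]
  have hc : Continuous fun ξ : ℝ => |ξ| ^ (1 / 2 : ℝ) :=
    continuous_abs.rpow_const fun _ => Or.inr (by norm_num)
  refine ((𝓕 φ).integrable.norm.add ((𝓕 φ).integrable_pow_mul volume 1)).mono'
    (((Complex.continuous_ofReal.comp hc).mul (𝓕 φ).continuous).aestronglyMeasurable)
    (ae_of_all _ fun ξ => ?_)
  simp only [norm_mul, Complex.norm_real, ← Real.sqrt_eq_rpow,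
    Real.norm_of_nonneg (Real.sqrt_nonneg _), Pi.add_apply, pow_one, Real.norm_eq_abs]
  have h : √|ξ| ≤ 1 + |ξ| := by
    rw [Real.sqrt_le_left (by positivity)]
    nlinarith [abs_nonneg ξ]
  nlinarith [norm_nonneg (𝓕 φ ξ)]

theorem enorm_Dop_half_BOGroup_le (φ : SchwartzMap ℝ ℂ) (x t : ℝ) :
    ‖Dop (1 / 2) (BOGroup t φ) x‖ₑ ≤
      ‖∫ ξ : ℝ, ((|ξ| ^ (1 / 2 : ℝ) : ℝ) : ℂ) *
        (Complex.exp (((2 * π * (ξ * x) : ℝ) : ℂ) * Complex.I) * 𝓕 (φ : ℝ → ℂ) ξ) *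
        Complex.exp (Complex.I * (t * (ξ * |ξ| : ℝ)))‖ₑ := by
  set g : ℝ → ℂ := fun ξ => Complex.exp (Complex.I * (t * ξ * |ξ|)) * 𝓕 (φ : ℝ → ℂ) ξ with hg
  have hc : Continuous (𝓕 (φ : ℝ → ℂ)) := by
    rw [← SchwartzMap.fourier_coe]
    exact (𝓕 φ).continuous
  have hi : Integrable (𝓕 (φ : ℝ → ℂ)) := by
    rw [← SchwartzMap.fourier_coe]
    exact (𝓕 φ).integrable
  have hgc : Continuous g := by fun_prop
  have hgi : Integrable g := by
    refine hi.mono hgc.aestronglyMeasurable (ae_of_all _ fun ξ => ?_)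
    rw [hg, norm_mul, Complex.norm_exp]
    simp
  unfold Dop FMul BOGroup FMul
  rcases fourier_fourierInv_eq_or_zero hgi hgc with h | h
  · rw [h, Real.fourierInv_eq']
    refine le_of_eq (congrArg _ (integral_congr_ae (ae_of_all _ fun ξ => ?_)))
    simp only [hg, smul_eq_mul, RCLike.inner_apply, conj_trivial]
    push_cast
    ring_nf
  · rw [h, Real.fourierInv_eq']
    simp

/-- **Kato smoothing effect for the Benjamin–Ono group.**
For every `φ ∈ 𝒮(ℝ)` and every `T > 0`,
`‖D_x^{1/2} V(t) φ‖_{L^∞_x L^2_T} ≲ ‖φ‖_{L²}`, with implicit constant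
independent of `φ` and `T`. -/
theorem kato_smoothing_BO :
    ∃ C : ℝ≥0, 0 < C ∧ ∀ (φ : SchwartzMap ℝ ℂ) (T : ℝ), 0 < T →
      LpLq ∞ 2 T (fun x t => Dop (1/2) (BOGroup t ⇑φ) x)
        ≤ C * eLpNorm ⇑φ 2 volume := by
  refine ⟨6, by norm_num, fun φ T hT => ?_⟩
  unfold LpLq
  rw [eLpNorm_exponent_top]
  refine eLpNormEssSup_le_of_ae_enorm_bound (ae_of_all _ fun x => ?_)
  rw [Real.enorm_of_nonneg ENNReal.toReal_nonneg]
  refine ENNReal.ofReal_toReal_le.trans ?_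
  rw [← ENNReal.pow_le_pow_left_iff two_ne_zero, eLpNorm_two_sq, mul_pow]
  have hc : Continuous (𝓕 (φ : ℝ → ℂ)) := by
    rw [← SchwartzMap.fourier_coe]
    exact (𝓕 φ).continuous
  have hexp : ∀ ξ : ℝ, ‖Complex.exp (((2 * π * (ξ * x) : ℝ) : ℂ) * Complex.I)‖ = 1 :=
    fun ξ => Complex.norm_exp_ofReal_mul_I _
  set b : ℝ → ℂ := fun ξ =>
    Complex.exp (((2 * π * (ξ * x) : ℝ) : ℂ) * Complex.I) * 𝓕 (φ : ℝ → ℂ) ξ with hb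
  have hbn : ∀ ξ, ‖b ξ‖ = ‖𝓕 (φ : ℝ → ℂ) ξ‖ := fun ξ => by
    rw [hb, norm_mul, hexp, one_mul]
  have hbc : Continuous b := by fun_prop
  have hrc : Continuous fun ξ : ℝ => |ξ| ^ (1 / 2 : ℝ) :=
    continuous_abs.rpow_const fun _ => Or.inr (by norm_num)
  have ha : Integrable fun ξ => ((|ξ| ^ (1 / 2 : ℝ) : ℝ) : ℂ) * b ξ := by
    refine (integrable_abs_rpow_half_mul_fourier φ).mono
      (((Complex.continuous_ofReal.comp hrc).mul hbc).aestronglyMeasurable)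
      (ae_of_all _ fun ξ => ?_)
    rw [norm_mul _ (b ξ), hbn, norm_mul]
  calc _ ≤ ∫⁻ t in Ioc 0 T, ‖∫ ξ, ((|ξ| ^ (1 / 2 : ℝ) : ℝ) : ℂ) * b ξ *
        Complex.exp (Complex.I * (t * (ξ * |ξ| : ℝ)))‖ₑ ^ 2 := by
        refine lintegral_mono fun t => ?_
        exact pow_le_pow_left₀ (by positivity) (enorm_Dop_half_BOGroup_le φ x t) 2
    _ ≤ 36 * ∫⁻ ξ, ‖b ξ‖ₑ ^ 2 := lintegral_oscillatory_sq_le hT hbc ha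
    _ = _ := by
        rw [← SchwartzMap.lintegral_enorm_fourier_sq]
        congr 1
        · norm_num
        · refine lintegral_congr fun ξ => ?_
          rw [← ofReal_norm, hbn, ofReal_norm]

end
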